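/- Characterization of bound variables in reducts: Let ⟨X, s, ∃x⃗.φ⟩ be a satisfiable existentially constrained term with ⟨X, s, ∃x⃗.φ⟩ →_{ρ,γ} ⟨Y, t, ∃y⃗.ψ⟩ a most general rewrite step using the left-linear constrained rewrite rule ρ: Π Z. ℓ → r [π] with Var(ρ) ∩ Var(s,φ) = ∅. Then: (1) BVar(⟨∃x⃗.φ⟩) ⊆ BVar(⟨∃y⃗.ψ⟩); (2) BVar(⟨∃x⃗.φ⟩) ∩ Var(ℓγ, rγ, πγ) = ∅; (3) Y ∪ BVar(⟨∃y⃗.ψ⟩) = ExVar(ρ) ∪ (X ∩ Var(t)) ∪ Var(ψ). -/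

import Mathlib

namespace LCTRS

open scoped Classical

noncomputable section

/-- First-order terms over function symbols `F` and variables `V`. -/
inductive Term (F V : Type) : Type where
  | var : V → Term F V
  | app : F → List (Term F V) → Term F V

variable {F V D : Type}

/-- Occurrence of a variable in a term. -/
inductive Term.VarIn (x : V) : Term F V → Prop where
  | var : Term.VarIn x (Term.var x)
  | app {f : F} {ts : List (Term F V)} {t : Term F V} :
      t ∈ ts → Term.VarIn x t → Term.VarIn x (Term.app f ts)

/-- The set of variables occurring in a term. -/
def Term.vars (t : Term F V) : Set V := {x | Term.VarIn x t}

/-- Application of a substitution to a term. -/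
def Term.subst (t : Term F V) (σ : V → Term F V) : Term F V :=
  match t with
  | .var x => σ x
  | .app f ts => .app f (ts.attach.map (fun u => u.1.subst σ))
decreasing_by
  have := List.sizeOf_lt_of_mem u.2
  simp only [Term.app.sizeOf_spec] at *
  omega

/-- The domain of a substitution. -/
def substDom (σ : V → Term F V) : Set V := {x | σ x ≠ Term.var x}

/-- Positions in a term. -/
abbrev Pos := List Nat

/-- `SubtermAt s p u`: the subterm of `s` at position `p` exists and equals `u`. -/
inductive SubtermAt : Term F V → Pos → Term F V → Prop where
  | refl (t : Term F V) : SubtermAt t [] t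
  | app {f : F} {ts : List (Term F V)} {i : Nat} {t u : Term F V} {p : Pos} :
      ts[i]? = some t → SubtermAt t p u → SubtermAt (Term.app f ts) (i :: p) u

/-- `ReplaceAt s p u t`: replacing the subterm of `s` at position `p` by `u` yields `t`. -/
inductive ReplaceAt : Term F V → Pos → Term F V → Term F V → Prop where
  | here (t u : Term F V) : ReplaceAt t [] u u
  | app {f : F} {ts : List (Term F V)} {i : Nat} {p : Pos} {u t t' : Term F V} :
      ts[i]? = some t → ReplaceAt t p u t' →
      ReplaceAt (Term.app f ts) (i :: p) u (Term.app f (ts.set i t'))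

/-- Replacement at a list of pairwise parallel positions (performed sequentially). -/
inductive ReplaceList : Term F V → List Pos → List (Term F V) → Term F V → Prop where
  | nil (t : Term F V) : ReplaceList t [] [] t
  | cons {t t₁ t₂ : Term F V} {p : Pos} {ps : List Pos} {u : Term F V} {us : List (Term F V)} :
      ReplaceAt t p u t₁ → ReplaceList t₁ ps us t₂ → ReplaceList t (p :: ps) (u :: us) t₂

/-- A term is linear if each variable occurs at most once in it. -/
def Term.Linear (t : Term F V) : Prop :=
  ∀ (x : V) (p q : Pos), SubtermAt t p (Term.var x) → SubtermAt t q (Term.var x) → p = q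

/-- A term is `X`-linear if each variable of `X` occurs at most once in it. -/
def Term.LinearOn (t : Term F V) (X : Set V) : Prop :=
  ∀ x ∈ X, ∀ (p q : Pos), SubtermAt t p (Term.var x) → SubtermAt t q (Term.var x) → p = q

/-- A model over the (theory part of the) signature: an interpretation of the function
symbols over a domain `D`, a designated truth value, a set `Val` of value constants such
that every domain element is denoted by some value, and designated conjunction, equality
and truth symbols interpreted as expected. -/
structure Model (F V D : Type) where
  interp : F → List D → D
  tval : D
  Val : Set F
  andSym : F
  eqSym : F
  trueSym : F
  val_const : ∀ v ∈ Val, ∀ ds : List D, interp v ds = interp v []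
  val_surj : ∀ d : D, ∃ v ∈ Val, interp v [] = d
  and_spec : ∀ a b : D, (interp andSym [a, b] = tval ↔ (a = tval ∧ b = tval))
  eq_spec : ∀ a b : D, (interp eqSym [a, b] = tval ↔ a = b)
  true_spec : interp trueSym [] = tval

/-- Evaluation of a term in a model under a valuation. -/
def Model.eval (M : Model F V D) (ξ : V → D) (t : Term F V) : D :=
  match t with
  | .var x => ξ x
  | .app f ts => M.interp f (ts.attach.map (fun u => M.eval ξ u.1))
decreasing_by
  have := List.sizeOf_lt_of_mem u.2
  simp only [Term.app.sizeOf_spec] at *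
  omega

/-- A constraint holds in `M` under the valuation `ξ`. -/
def Model.holds (M : Model F V D) (ξ : V → D) (φ : Term F V) : Prop := M.eval ξ φ = M.tval

/-- `⊨_M φ`: the constraint `φ` holds under every valuation. -/
def Model.validC (M : Model F V D) (φ : Term F V) : Prop := ∀ ξ : V → D, M.holds ξ φ

/-- `t` is a value (a constant from `Val`). -/
def Model.IsValueTerm (M : Model F V D) (t : Term F V) : Prop := ∃ v ∈ M.Val, t = Term.app v []

/-- The root symbol of `t` is a value symbol. -/
def Model.IsValueSym (M : Model F V D) (t : Term F V) : Prop :=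
  ∃ v ∈ M.Val, ∃ ts : List (Term F V), t = Term.app v ts

/-- No value occurs in `t`. -/
def Term.ValueFree (t : Term F V) (M : Model F V D) : Prop :=
  ∀ (p : Pos) (u : Term F V), SubtermAt t p u → ¬ M.IsValueSym u

/-- The conjunction `φ ∧ ψ` as a constraint. -/
def Model.conj (M : Model F V D) (φ ψ : Term F V) : Term F V := Term.app M.andSym [φ, ψ]

/-- The equation `s = t` as a constraint. -/
def Model.eqc (M : Model F V D) (s t : Term F V) : Term F V := Term.app M.eqSym [s, t]

/-- The constraint `true`. -/
def Model.trueC (M : Model F V D) : Term F V := Term.app M.trueSym []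

/-- `φ ∧ ψ₁ ∧ ⋯ ∧ ψₙ`. -/
def Model.conjFrom (M : Model F V D) (φ : Term F V) (l : List (Term F V)) : Term F V :=
  l.foldl M.conj φ

/-- `ψ₁ ∧ ⋯ ∧ ψₙ`. -/
def Model.bigConj (M : Model F V D) (l : List (Term F V)) : Term F V :=
  l.foldl M.conj M.trueC

/-- An existential constraint `⟨∃x⃗. φ⟩`: a set of (bound) variables together with a
constraint. -/
structure EC (F V : Type) where
  bvars : Set V
  constr : Term F V

/-- Well-formedness of an existential constraint: `{x⃗} ⊆ Var(φ)`. -/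
def EC.WF (c : EC F V) : Prop := c.bvars ⊆ c.constr.vars

/-- Free variables of an existential constraint. -/
def EC.fvars (c : EC F V) : Set V := c.constr.vars \ c.bvars

/-- `⟨∃x⃗. φ⟩` holds under valuation `ξ`: `φκ` holds under `ξ` for some substitution `κ`
mapping `x⃗` into `Val` (and the identity elsewhere). -/
def EC.holdsUnder (c : EC F V) (M : Model F V D) (ξ : V → D) : Prop :=
  ∃ κ : V → Term F V, (∀ x ∈ c.bvars, M.IsValueTerm (κ x)) ∧
    (∀ x ∉ c.bvars, κ x = Term.var x) ∧ M.holds ξ (c.constr.subst κ)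

/-- `⊨_M ⟨∃x⃗. φ⟩`. -/
def EC.validM (c : EC F V) (M : Model F V D) : Prop := ∀ ξ : V → D, c.holdsUnder M ξ

/-- Satisfiability of an existential constraint. -/
def EC.satisfiable (c : EC F V) (M : Model F V D) : Prop := ∃ ξ : V → D, c.holdsUnder M ξ

/-- Application of a substitution to an existential constraint acts on the free
variables only. -/
def EC.subst (c : EC F V) (σ : V → Term F V) : EC F V :=
  ⟨c.bvars, c.constr.subst (fun x => if x ∈ c.bvars then Term.var x else σ x)⟩

/-- `⊨_M ⟨∃x⃗.φ⟩ ⇔ ⟨∃y⃗.ψ⟩`. -/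
def ECIffM (M : Model F V D) (c c' : EC F V) : Prop :=
  ∀ ξ : V → D, c.holdsUnder M ξ ↔ c'.holdsUnder M ξ

/-- `σ ⊨_M ⟨∃x⃗.φ⟩`: `σ` maps the free variables into values and `(⟨∃x⃗.φ⟩)σ` is valid. -/
def SubstRespectsEC (M : Model F V D) (σ : V → Term F V) (c : EC F V) : Prop :=
  (∀ x ∈ c.fvars, M.IsValueTerm (σ x)) ∧ (c.subst σ).validM M

/-- `σ` respects the plain constraint `φ`. -/
def SubstRespects (M : Model F V D) (σ : V → Term F V) (φ : Term F V) : Prop :=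
  (∀ x ∈ φ.vars, M.IsValueTerm (σ x)) ∧ M.validC (φ.subst σ)

/-- An existentially constrained term `⟨X, s, ∃x⃗.φ⟩`. -/
structure ECTerm (F V : Type) where
  lvars : Set V
  term : Term F V
  ec : EC F V

/-- Well-formedness: `{x⃗} ⊆ Var(φ)`, `FVar(⟨∃x⃗.φ⟩) ⊆ X ⊆ Var(s)` and `{x⃗} ∩ Var(s) = ∅`. -/
def ECTerm.WF (T : ECTerm F V) : Prop :=
  T.ec.WF ∧ T.ec.fvars ⊆ T.lvars ∧ T.lvars ⊆ T.term.vars ∧ ∀ x ∈ T.ec.bvars, x ∉ T.term.vars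

/-- Satisfiability of an existentially constrained term. -/
def ECTerm.satisfiable (T : ECTerm F V) (M : Model F V D) : Prop := T.ec.satisfiable M

/-- `T` is subsumed by `T'`. -/
def SubsumedBy (M : Model F V D) (T T' : ECTerm F V) : Prop :=
  ∀ σ : V → Term F V, (∀ x ∈ T.lvars, M.IsValueTerm (σ x)) → SubstRespectsEC M σ T.ec →
    ∃ γ : V → Term F V, (∀ y ∈ T'.lvars, M.IsValueTerm (γ y)) ∧ SubstRespectsEC M γ T'.ec ∧
      T.term.subst σ = T'.term.subst γ

/-- Equivalence of existentially constrained terms. -/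
def ECEquiv (M : Model F V D) (T T' : ECTerm F V) : Prop :=
  SubsumedBy M T T' ∧ SubsumedBy M T' T

/-- An existentially constrained term is pattern-general if its term is linear in its
logical variables and contains no value. -/
def ECTerm.PatternGeneral (T : ECTerm F V) (M : Model F V D) : Prop :=
  T.term.LinearOn T.lvars ∧ T.term.ValueFree M

/-- A constrained rewrite rule `Π Z. ℓ → r [π]`. -/
structure Rule (F V : Type) where
  Z : Set V
  lhs : Term F V
  rhs : Term F V
  constr : Term F V

/-- `Var(ρ)`. -/
def Rule.vars (ρ : Rule F V) : Set V := ρ.lhs.vars ∪ ρ.rhs.vars ∪ ρ.constr.vars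

/-- `ExVar(ρ) = Var(r) \ Var(ℓ)`. -/
def Rule.exVars (ρ : Rule F V) : Set V := ρ.rhs.vars \ ρ.lhs.vars

/-- Well-formedness of a rule: `(Var(r) \ Var(ℓ)) ∪ Var(π) ⊆ Z ⊆ Var(ℓ,r,π)`. -/
def Rule.WF (ρ : Rule F V) : Prop :=
  (ρ.rhs.vars \ ρ.lhs.vars) ∪ ρ.constr.vars ⊆ ρ.Z ∧ ρ.Z ⊆ ρ.vars

/-- Left-linearity. -/
def Rule.LeftLinear (ρ : Rule F V) : Prop := ρ.lhs.Linear

/-- A rule is left-value-free if it is left-linear and no value occurs in its lhs. -/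
def Rule.LeftValueFree (ρ : Rule F V) (M : Model F V D) : Prop :=
  ρ.LeftLinear ∧ ρ.lhs.ValueFree M

/-- `ρ'` is a renamed variant of `ρ`. -/
def Rule.IsVariantOf (ρ' ρ : Rule F V) : Prop :=
  ∃ δ : V → V, Function.Bijective δ ∧
    ρ'.Z = δ '' ρ.Z ∧ ρ'.lhs = ρ.lhs.subst (fun x => Term.var (δ x)) ∧
    ρ'.rhs = ρ.rhs.subst (fun x => Term.var (δ x)) ∧
    ρ'.constr = ρ.constr.subst (fun x => Term.var (δ x))

/-- `⟨X,s,∃x⃗.φ⟩` has a `ρ`-redex at position `p` using substitution `γ`. -/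
structure RedexAt (M : Model F V D) (ρ : Rule F V) (T : ECTerm F V)
    (p : Pos) (γ : V → Term F V) : Prop where
  dom : substDom γ = ρ.lhs.vars
  matchAt : SubtermAt T.term p (ρ.lhs.subst γ)
  lvar : ∀ x ∈ ρ.lhs.vars ∩ ρ.Z, M.IsValueTerm (γ x) ∨ ∃ y ∈ T.lvars, γ x = Term.var y
  implied : ∀ ξ : V → D, T.ec.holdsUnder M ξ →
    EC.holdsUnder ⟨ρ.constr.vars \ ρ.lhs.vars, ρ.constr.subst γ⟩ M ξ

/-- A most general rewrite step at position `p` using substitution `γ`. -/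
structure MGStepData (M : Model F V D) (ρ : Rule F V) (T T' : ECTerm F V)
    (p : Pos) (γ : V → Term F V) : Prop where
  redex : RedexAt M ρ T p γ
  target : ReplaceAt T.term p (ρ.rhs.subst γ) T'.term
  cstr : T'.ec.constr = M.conj T.ec.constr (ρ.constr.subst γ)
  bnd : T'.ec.bvars = T'.ec.constr.vars \ T'.term.vars
  lv : T'.lvars = ρ.exVars ∪ (T.lvars ∩ T'.term.vars)

/-- A most general rewrite step at position `p`. -/
def MGStepAt (M : Model F V D) (ρ : Rule F V) (p : Pos) (T T' : ECTerm F V) : Prop :=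
  ∃ γ : V → Term F V, MGStepData M ρ T T' p γ

/-- A most general rewrite step. -/
def MGStep (M : Model F V D) (ρ : Rule F V) (T T' : ECTerm F V) : Prop :=
  ∃ (p : Pos) (γ : V → Term F V), MGStepData M ρ T T' p γ

/-- A non-quantified constrained term `⟨X, s, φ⟩`. -/
structure NQTerm (F V : Type) where
  lvars : Set V
  term : Term F V
  constr : Term F V

/-- Well-formedness: `Var(φ) ⊆ X ⊆ Var(φ, s)`. -/
def NQTerm.WF (T : NQTerm F V) : Prop :=
  T.constr.vars ⊆ T.lvars ∧ T.lvars ⊆ T.constr.vars ∪ T.term.vars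

/-- Satisfiability of a non-quantified constrained term. -/
def NQTerm.satisfiable (T : NQTerm F V) (M : Model F V D) : Prop :=
  ∃ ξ : V → D, M.holds ξ T.constr

/-- Subsumption of non-quantified constrained terms. -/
def NQSubsumedBy (M : Model F V D) (T T' : NQTerm F V) : Prop :=
  ∀ σ : V → Term F V, (∀ x ∈ T.lvars, M.IsValueTerm (σ x)) → SubstRespects M σ T.constr →
    ∃ γ : V → Term F V, (∀ y ∈ T'.lvars, M.IsValueTerm (γ y)) ∧ SubstRespects M γ T'.constr ∧
      T.term.subst σ = T'.term.subst γ

/-- Equivalence of non-quantified constrained terms. -/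
def NQEquiv (M : Model F V D) (T T' : NQTerm F V) : Prop :=
  NQSubsumedBy M T T' ∧ NQSubsumedBy M T' T

/-- A rewrite step on non-quantified constrained terms at position `p` using `σ`. -/
structure NQStepData (M : Model F V D) (ρ : Rule F V) (T T' : NQTerm F V)
    (p : Pos) (σ : V → Term F V) : Prop where
  fresh : Disjoint ρ.vars (T.lvars ∪ T.term.vars ∪ T.constr.vars)
  funpos : ∃ (f : F) (ts : List (Term F V)), SubtermAt T.term p (Term.app f ts)
  dom : substDom σ = ρ.vars
  matchAt : SubtermAt T.term p (ρ.lhs.subst σ)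
  zval : ∀ x ∈ ρ.Z, M.IsValueTerm (σ x) ∨ ∃ y ∈ T.lvars, σ x = Term.var y
  implied : ∀ ξ : V → D, M.holds ξ T.constr → M.holds ξ (ρ.constr.subst σ)
  target : ReplaceAt T.term p (ρ.rhs.subst σ) T'.term
  cstr : T'.constr = T.constr
  lv : T'.lvars = T.lvars ∩ (T'.term.vars ∪ T.constr.vars)

/-- A rewrite step on non-quantified constrained terms. -/
def NQStep (M : Model F V D) (ρ : Rule F V) (T T' : NQTerm F V) : Prop :=
  ∃ (p : Pos) (σ : V → Term F V), NQStepData M ρ T T' p σ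

/-- The existential removing translation `rmv`. -/
def rmv (T : ECTerm F V) : NQTerm F V := ⟨T.lvars ∪ T.ec.bvars, T.term, T.ec.constr⟩

/-- The existential extension translation `ext`. -/
def ext (T : NQTerm F V) : ECTerm F V :=
  ⟨T.lvars \ (T.constr.vars \ T.term.vars), T.term, ⟨T.constr.vars \ T.term.vars, T.constr⟩⟩

/-- Positions of `s` whose symbol is a variable of `X` or a value. -/
def PosXVal (M : Model F V D) (X : Set V) (s : Term F V) : Set Pos :=
  {p | ∃ u : Term F V, SubtermAt s p u ∧ ((∃ x ∈ X, u = Term.var x) ∨ M.IsValueSym u)}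

/-- `s'` is the bullet translation `s^{•X}` of `s`, obtained by replacing the subterms at
the positions `ps` (which enumerate `Pos_{X∪Val}(s)`) by the pairwise distinct fresh
variables `xs`. -/
structure BulletData (M : Model F V D) (X avoid : Set V) (s : Term F V)
    (ps : List Pos) (xs : List V) (s' : Term F V) : Prop where
  nodup_ps : ps.Nodup
  cover : ∀ p : Pos, p ∈ ps ↔ p ∈ PosXVal M X s
  nodup_xs : xs.Nodup
  len : xs.length = ps.length
  fresh : ∀ x ∈ xs, x ∉ avoid
  repl : ReplaceList s ps (xs.map Term.var) s'

/-- `T'` is the pattern-general translation `PG(T)` of `T` (with fresh variables chosen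
outside `avoid`). -/
def IsPG (M : Model F V D) (avoid : Set V) (T T' : ECTerm F V) : Prop :=
  ∃ (ps : List Pos) (xs : List V) (us : List (Term F V)),
    BulletData M T.lvars avoid T.term ps xs T'.term ∧
    List.Forall₂ (fun p u => SubtermAt T.term p u) ps us ∧
    T'.lvars = {x | x ∈ xs} ∧
    T'.ec.bvars = T.ec.bvars ∪ T.lvars ∧
    T'.ec.constr = M.conjFrom T.ec.constr (List.zipWith M.eqc us (xs.map Term.var))

/-- `ρh` is the left-value-free transformation `lvf(ρ)` of `ρ`. -/
def IsLVF (M : Model F V D) (ρ ρh : Rule F V) : Prop :=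
  ∃ (ps : List Pos) (xs : List V) (vs : List (Term F V)),
    ps.Nodup ∧ xs.Nodup ∧ xs.length = ps.length ∧
    (∀ p : Pos, p ∈ ps ↔ p ∈ PosXVal M (∅ : Set V) ρ.lhs) ∧
    List.Forall₂ (fun p v => SubtermAt ρ.lhs p v ∧ M.IsValueTerm v) ps vs ∧
    (∀ x ∈ xs, x ∉ ρ.vars) ∧
    ρh.Z = ρ.Z ∪ {x | x ∈ xs} ∧
    ReplaceList ρ.lhs ps (xs.map Term.var) ρh.lhs ∧
    ρh.rhs = ρ.rhs ∧
    ρh.constr = M.conjFrom ρ.constr (List.zipWith M.eqc (xs.map Term.var) vs)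

/-- A most general rewrite step with a fresh variant of some rule of the LCTRS `R`. -/
def StepR (M : Model F V D) (R : Set (Rule F V)) (T T' : ECTerm F V) : Prop :=
  ∃ ρ ∈ R, ∃ ρ' : Rule F V, ρ'.IsVariantOf ρ ∧
    Disjoint ρ'.vars (T.term.vars ∪ T.ec.constr.vars) ∧ MGStep M ρ' T T'

/-- One `∼ · →_R` step (on well-formed, satisfiable existentially constrained terms). -/
def SimStep (M : Model F V D) (R : Set (Rule F V)) (T T' : ECTerm F V) : Prop :=
  ∃ U : ECTerm F V, U.WF ∧ U.satisfiable M ∧ ECEquiv M T U ∧ StepR M R U T'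

/-- `n`-fold composition of a relation. -/
def RelPow {α : Type _} (r : α → α → Prop) : ℕ → α → α → Prop
  | 0 => fun a b => a = b
  | n + 1 => fun a c => ∃ b, r a b ∧ RelPow r n b c


/-- The variables of an instance `tσ` are the variables of the terms `σ y`, for `y` in `t`. -/
theorem Term.mem_vars_subst {F V : Type} (σ : V → Term F V) (x : V) :
    ∀ t : Term F V, x ∈ (t.subst σ).vars ↔ ∃ y ∈ t.vars, x ∈ (σ y).vars
  | .var z => by
    rw [Term.subst]
    constructor
    · exact fun h => ⟨z, Term.VarIn.var, h⟩
    · rintro ⟨y, hy, h⟩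
      cases hy
      exact h
  | .app f ts => by
    rw [Term.subst]
    constructor
    · intro h
      cases h with
      | app hmem hx =>
        obtain ⟨u, -, rfl⟩ := List.mem_map.1 hmem
        have := List.sizeOf_lt_of_mem u.2
        obtain ⟨y, hy, hxy⟩ := (Term.mem_vars_subst σ x u.1).1 hx
        exact ⟨y, Term.VarIn.app u.2 hy, hxy⟩
    · rintro ⟨y, hy, hxy⟩
      cases hy with
      | app hmem hy =>
        rename_i u
        have := List.sizeOf_lt_of_mem hmem
        exact Term.VarIn.app (List.mem_map.2 ⟨⟨u, hmem⟩, List.mem_attach _ _, rfl⟩)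
          ((Term.mem_vars_subst σ x u).2 ⟨y, hy, hxy⟩)
termination_by t => sizeOf t
decreasing_by
  all_goals
    simp only [Term.app.sizeOf_spec]
    omega

theorem SubtermAt.vars_subset {F V : Type} {s u : Term F V} {p : Pos} (h : SubtermAt s p u) :
    u.vars ⊆ s.vars := by
  induction h with
  | refl => exact subset_rfl
  | app hi _ ih => exact fun x hx => Term.VarIn.app (List.mem_of_getElem? hi) (ih hx)

theorem ReplaceAt.vars_subset {F V : Type} {s u t : Term F V} {p : Pos}
    (h : ReplaceAt s p u t) : t.vars ⊆ s.vars ∪ u.vars := by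
  induction h with
  | here => exact Set.subset_union_right
  | app hi _ ih =>
    intro x hx
    cases hx with
    | app hmem hx =>
      rcases List.mem_or_eq_of_mem_set hmem with hmem | rfl
      · exact Or.inl (Term.VarIn.app hmem hx)
      · exact (ih hx).imp_left (Term.VarIn.app (List.mem_of_getElem? hi))

theorem Model.IsValueTerm.notMem_vars {F V D : Type} {M : Model F V D} {t : Term F V}
    (h : M.IsValueTerm t) (x : V) : x ∉ t.vars := by
  obtain ⟨v, -, rfl⟩ := h
  intro hx
  cases hx with
  | app hmem _ => exact List.not_mem_nil hmem

theorem Model.vars_conj {F V D : Type} (M : Model F V D) (φ ψ : Term F V) :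
    (M.conj φ ψ).vars = φ.vars ∪ ψ.vars := by
  ext x
  constructor
  · intro h
    cases h with
    | app hmem hx =>
      rcases List.mem_pair.1 hmem with rfl | rfl
      · exact Or.inl hx
      · exact Or.inr hx
  · rintro (h | h)
    · exact Term.VarIn.app (List.mem_pair.2 (Or.inl rfl)) h
    · exact Term.VarIn.app (List.mem_pair.2 (Or.inr rfl)) h

theorem RedexAt.apply_eq_var {F V D : Type} {M : Model F V D} {ρ : Rule F V}
    {T : ECTerm F V} {p : Pos} {γ : V → Term F V} (h : RedexAt M ρ T p γ) {y : V}
    (hy : y ∉ ρ.lhs.vars) : γ y = Term.var y := by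
  by_contra hne
  exact hy (h.dom ▸ hne)

/-- A matching substitution sends a variable outside the left-hand side to itself, and every
other variable to a term whose variables occur in the rewritten term. -/
theorem RedexAt.mem_vars_or_eq {F V D : Type} {M : Model F V D} {ρ : Rule F V}
    {T : ECTerm F V} {p : Pos} {γ : V → Term F V} (h : RedexAt M ρ T p γ) {x y : V}
    (hx : x ∈ (γ y).vars) : x ∈ T.term.vars ∨ (y ∉ ρ.lhs.vars ∧ x = y) := by
  by_cases hy : y ∈ ρ.lhs.vars
  · exact Or.inl (h.matchAt.vars_subset ((Term.mem_vars_subst γ x _).2 ⟨y, hy, hx⟩))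
  · rw [h.apply_eq_var hy] at hx
    cases hx
    exact Or.inr ⟨hy, rfl⟩

/-- **Characterization of Bound Variables in Reducts.** -/
theorem bound_vars_of_reducts {F V D : Type} (M : Model F V D)
    (T T' : ECTerm F V) (ρ : Rule F V) (p : Pos) (γ : V → Term F V)
    (hT : T.WF) (hsat : T.satisfiable M)
    (hρ : ρ.WF) (hll : ρ.LeftLinear)
    (hdisj : Disjoint ρ.vars (T.term.vars ∪ T.ec.constr.vars))
    (hstep : MGStepData M ρ T T' p γ) :
    T.ec.bvars ⊆ T'.ec.bvars ∧
    Disjoint T.ec.bvars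
      ((ρ.lhs.subst γ).vars ∪ (ρ.rhs.subst γ).vars ∪ (ρ.constr.subst γ).vars) ∧
    T'.lvars ∪ T'.ec.bvars = ρ.exVars ∪ (T.lvars ∩ T'.term.vars) ∪ T'.ec.constr.vars := by
  obtain ⟨hbφ, hfv, -, hbs⟩ := hT
  obtain ⟨hred, htgt, hcstr, hbnd, hlv⟩ := hstep
  have hfresh : ∀ x ∈ ρ.vars, x ∉ T.term.vars ∧ x ∉ T.ec.constr.vars := fun x hx =>
    ⟨fun h => Set.disjoint_left.1 hdisj hx (Or.inl h),
      fun h => Set.disjoint_left.1 hdisj hx (Or.inr h)⟩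
  have hinst : ∀ x ∈ T.ec.bvars, ∀ u : Term F V, u.vars ⊆ ρ.vars → x ∉ (u.subst γ).vars := by
    intro x hx u hu h
    obtain ⟨y, hy, hxy⟩ := (Term.mem_vars_subst γ x u).1 h
    rcases hred.mem_vars_or_eq hxy with hs | ⟨-, rfl⟩
    · exact hbs x hx hs
    · exact (hfresh x (hu hy)).2 (hbφ hx)
  have hl : ρ.lhs.vars ⊆ ρ.vars := fun x h => Or.inl (Or.inl h)
  have hr : ρ.rhs.vars ⊆ ρ.vars := fun x h => Or.inl (Or.inr h)
  have hπ : ρ.constr.vars ⊆ ρ.vars := fun x h => Or.inr h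
  have hbt : ∀ x ∈ T.ec.bvars, x ∉ T'.term.vars := fun x hx h =>
    (htgt.vars_subset h).elim (hbs x hx) (hinst x hx _ hr)
  have hψ : T'.ec.constr.vars = T.ec.constr.vars ∪ (ρ.constr.subst γ).vars := by
    rw [hcstr, M.vars_conj]
  refine ⟨fun x hx => ?_, ?_, ?_⟩
  · rw [hbnd, hψ]
    exact ⟨Or.inl (hbφ hx), hbt x hx⟩
  · refine Set.disjoint_left.2 fun x hx => ?_
    rintro ((h | h) | h)
    exacts [hinst x hx _ hl h, hinst x hx _ hr h, hinst x hx _ hπ h]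
  · have key : T'.ec.constr.vars ∩ T'.term.vars ⊆ ρ.exVars ∪ (T.lvars ∩ T'.term.vars) := by
      rintro x ⟨hx, hxt⟩
      rcases hψ ▸ hx with hx | hx
      · exact Or.inr ⟨hfv ⟨hx, fun hb => hbt x hb hxt⟩, hxt⟩
      obtain ⟨y, hy, hxy⟩ := (Term.mem_vars_subst γ x _).1 hx
      by_cases hyl : y ∈ ρ.lhs.vars
      · rcases hred.lvar y ⟨hyl, hρ.1 (Or.inr hy)⟩ with hv | ⟨z, hz, hγ⟩
        · exact absurd hxy (hv.notMem_vars x)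
        · rw [hγ] at hxy
          cases hxy
          exact Or.inr ⟨hz, hxt⟩
      rw [hred.apply_eq_var hyl] at hxy
      cases hxy
      have hxs := (hfresh x (hπ hy)).1
      rcases htgt.vars_subset hxt with hs | hrx
      · exact absurd hs hxs
      obtain ⟨z, hz, hxz⟩ := (Term.mem_vars_subst γ x _).1 hrx
      rcases hred.mem_vars_or_eq hxz with hs | ⟨hzl, rfl⟩
      · exact absurd hs hxs
      · exact Or.inl ⟨hz, hzl⟩
    rw [hlv, hbnd]
    ext x
    constructor
    · exact Or.imp_right And.left
    · rintro (h | h)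
      · exact Or.inl h
      · by_cases hxt : x ∈ T'.term.vars
        · exact Or.inl (key ⟨h, hxt⟩)
        · exact Or.inr ⟨h, hxt⟩

end

end LCTRS
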